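/- For all x, y ∈ ℂ with θ₁(x|5τ) ≠ 0 and θ₁(y|5τ) ≠ 0, one has (θ₁(x+π/5|τ) − θ₁(x−π/5|τ))(θ₁(y+2π/5|τ) − θ₁(y−2π/5|τ)) − (θ₁(y+π/5|τ) − θ₁(y−π/5|τ))(θ₁(x+2π/5|τ) − θ₁(x−2π/5|τ)) = 5·θ₁(x+y|5τ)θ₁(x−y|5τ)θ₁(2x|5τ)θ₁(2y|5τ) / (θ₁(x|5τ)θ₁(y|5τ)). -/

import Mathlib

noncomputable section

open Complex

namespace Liu

/-- `π` as a complex number. -/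
def piC : ℂ := Real.pi

/-- The nome `q = exp(2πiτ)`. -/
def qq (τ : ℂ) : ℂ := exp (2 * piC * I * τ)

/-- Jacobi theta function θ₁(z|τ). -/
def theta1 (z τ : ℂ) : ℂ :=
  -I * exp (piC * I * τ / 4) *
    ∑' n : ℤ, (-1 : ℂ) ^ n * exp (piC * I * τ * (n : ℂ) * ((n : ℂ) + 1)) *
      exp ((2 * (n : ℂ) + 1) * I * z)

/-- Jacobi theta function θ₂(z|τ). -/
def theta2 (z τ : ℂ) : ℂ :=
  2 * ∑' n : ℕ, exp (piC * I * τ * (2 * (n : ℂ) + 1) ^ 2 / 4) * cos ((2 * (n : ℂ) + 1) * z)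

/-- Jacobi theta function θ₃(z|τ). -/
def theta3 (z τ : ℂ) : ℂ :=
  1 + 2 * ∑' n : ℕ, exp (piC * I * τ * ((n : ℂ) + 1) ^ 2) * cos (2 * ((n : ℂ) + 1) * z)

/-- Jacobi theta function θ₄(z|τ). -/
def theta4 (z τ : ℂ) : ℂ :=
  1 + 2 * ∑' n : ℕ, (-1 : ℂ) ^ (n + 1) * exp (piC * I * τ * ((n : ℂ) + 1) ^ 2) *
    cos (2 * ((n : ℂ) + 1) * z)

/-- θ₁'(τ) = (∂θ₁/∂z)(0|τ). -/
def theta1' (τ : ℂ) : ℂ := deriv (fun z => theta1 z τ) 0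

/-- The Dedekind eta function. -/
def eta (τ : ℂ) : ℂ := exp (piC * I * τ / 12) * ∏' n : ℕ, (1 - qq τ ^ (n + 1))

/-- Eisenstein series L = E₂. -/
def EisL (τ : ℂ) : ℂ :=
  1 - 24 * ∑' n : ℕ, ((n : ℂ) + 1) * qq τ ^ (n + 1) / (1 - qq τ ^ (n + 1))

/-- Eisenstein series M = E₄. -/
def EisM (τ : ℂ) : ℂ :=
  1 + 240 * ∑' n : ℕ, ((n : ℂ) + 1) ^ 3 * qq τ ^ (n + 1) / (1 - qq τ ^ (n + 1))

/-- The period lattice Λ = {mπ + nπτ : m, n ∈ ℤ}. -/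
def Lambda (τ : ℂ) : Set ℂ := {z | ∃ m n : ℤ, z = (m : ℂ) * piC + (n : ℂ) * piC * τ}

/-- The Weierstrass ℘ function attached to the lattice with periods π and πτ. -/
def wp (τ z : ℂ) : ℂ :=
  1 / z ^ 2 + ∑' p : ℤ × ℤ,
    if p = (0, 0) then 0
    else 1 / (z - ((p.1 : ℂ) * piC + (p.2 : ℂ) * piC * τ)) ^ 2
      - 1 / ((p.1 : ℂ) * piC + (p.2 : ℂ) * piC * τ) ^ 2

/-- The `n`-th summand of `θ₁(z|τ)`, up to the constant `-i` and the sign `(-1)ⁿ`. -/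
def thetaExp (τ : ℂ) (n : ℤ) (z : ℂ) : ℂ :=
  exp (piC * I * τ * (2 * (n : ℂ) + 1) ^ 2 / 4 + (2 * (n : ℂ) + 1) * I * z)

lemma piC_ne_zero : piC ≠ 0 := by
  simp [piC, Real.pi_ne_zero]

lemma summable_thetaExp {τ : ℂ} (hτ : 0 < τ.im) (z : ℂ) :
    Summable fun n : ℤ => (-1 : ℂ) ^ n * thetaExp τ n z := by
  have h := ((summable_jacobiTheta₂_term_iff (z / piC + (τ + 1) / 2) τ).2 hτ).mul_left
    (exp (piC * I * τ / 4 + I * z))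
  refine h.congr fun n => ?_
  have h1 : (-1 : ℂ) ^ n = exp (n * (piC * I)) := by
    rw [exp_int_mul, piC, exp_pi_mul_I]
  rw [jacobiTheta₂_term, thetaExp, h1, ← exp_add, ← exp_add]
  congr 1
  have := piC_ne_zero
  change _ + (2 * piC * I * n * (z / piC + (τ + 1) / 2) + piC * I * n ^ 2 * τ) = _
  field_simp
  ring

lemma hasSum_theta1 {τ : ℂ} (hτ : 0 < τ.im) (z : ℂ) :
    HasSum (fun n : ℤ => (-1 : ℂ) ^ n * thetaExp τ n z) (I * theta1 z τ) := by
  have h := (summable_thetaExp hτ z).hasSum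
  convert h using 1
  rw [theta1, ← tsum_mul_left, ← tsum_mul_left]
  refine tsum_congr fun n => ?_
  have h1 : thetaExp τ n z = exp (piC * I * τ / 4) *
      exp (piC * I * τ * (n : ℂ) * ((n : ℂ) + 1)) * exp ((2 * (n : ℂ) + 1) * I * z) := by
    rw [thetaExp, ← exp_add, ← exp_add]
    congr 1
    ring
  rw [h1]
  linear_combination (-(exp (piC * I * τ / 4) * (-1) ^ n *
      exp (piC * I * τ * (n : ℂ) * ((n : ℂ) + 1)) * exp ((2 * (n : ℂ) + 1) * I * z))) * I_mul_I

lemma hasSum_of_eq {ι : Type*} {f g : ι → ℂ} {a b : ℂ} (h : HasSum f a)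
    (hfg : ∀ i, g i = f i) (hab : b = a) : HasSum g b := by
  rwa [hab, funext hfg]

lemma _root_.HasSum.mul_complex {ι κ : Type*} {f : ι → ℂ} {g : κ → ℂ} {a b : ℂ}
    (hf : HasSum f a) (hg : HasSum g b) :
    HasSum (fun p : ι × κ => f p.1 * g p.2) (a * b) :=
  hf.mul hg (summable_mul_of_summable_norm hf.summable.norm hg.summable.norm)

lemma hasSum_theta1_mul {τ : ℂ} (hτ : 0 < τ.im) (z w : ℂ) :
    HasSum (fun p : ℤ × ℤ => (-1 : ℂ) ^ (p.1 + p.2) * (thetaExp τ p.1 z * thetaExp τ p.2 w))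
      (-(theta1 z τ * theta1 w τ)) := by
  refine hasSum_of_eq ((hasSum_theta1 hτ z).mul_complex (hasSum_theta1 hτ w)) (fun p => ?_) ?_
  · rw [zpow_add₀ (by norm_num)]
    ring
  · linear_combination (-(theta1 z τ * theta1 w τ)) * I_mul_I

/-- Reindexing a sum along an injection, extending by zero outside a predicate for its range. -/
lemma hasSum_ite_of_range {ι κ : Type*} {f : κ → ℂ} {a : ℂ} (g : ι → κ)
    (hg : Function.Injective g) (P : κ → Prop) [DecidablePred P]
    (hP : ∀ k, P k ↔ k ∈ Set.range g) (h : HasSum (f ∘ g) a) :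
    HasSum (fun k => if P k then f k else 0) a := by
  rw [← hg.hasSum_iff]
  · convert h using 1
    ext i
    simp [(hP (g i)).2 ⟨i, rfl⟩]
  · intro k hk
    simp [(hP k).not.2 hk]

/-- The sum of `q^{n²/4} e^{2inz}` over `n` of the form `2k + j`. -/
def thetaHalf (τ : ℂ) (j : ℤ) (z : ℂ) : ℂ :=
  ∑' k : ℤ, exp (piC * I * τ * ((2 * k + j : ℤ) : ℂ) ^ 2 / 2 + 2 * ((2 * k + j : ℤ) : ℂ) * I * z)

lemma hasSum_thetaHalf {τ : ℂ} (hτ : 0 < τ.im) (j : ℤ) (z : ℂ) :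
    HasSum (fun k : ℤ => exp (piC * I * τ * ((2 * k + j : ℤ) : ℂ) ^ 2 / 2 +
      2 * ((2 * k + j : ℤ) : ℂ) * I * z)) (thetaHalf τ j z) := by
  refine Summable.hasSum ?_
  have hτ2 : 0 < (τ / 2).im := by
    simpa using hτ
  have h := (summable_jacobiTheta₂_term_iff (z / piC) (τ / 2)).2 hτ2
  have hinj : Function.Injective fun k : ℤ => 2 * k + j := fun a b hab => by
    simp only at hab
    lia
  refine (h.comp_injective hinj).congr fun k => ?_
  simp only [Function.comp, jacobiTheta₂_term]
  congr 1
  have := piC_ne_zero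
  change 2 * piC * I * _ * (z / piC) + piC * I * _ ^ 2 * (τ / 2) = _
  field_simp
  ring

lemma theta1_add_mul_theta1_sub {τ : ℂ} (hτ : 0 < τ.im) (a b : ℂ) :
    theta1 (a + b) τ * theta1 (a - b) τ =
      thetaHalf τ 0 a * thetaHalf τ 1 b - thetaHalf τ 1 a * thetaHalf τ 0 b := by
  set f : ℤ × ℤ → ℂ := fun p =>
    (-1 : ℂ) ^ (p.1 + p.2) * (thetaExp τ p.1 (a + b) * thetaExp τ p.2 (a - b)) with hf
  have h0 : HasSum f _ := hasSum_theta1_mul hτ (a + b) (a - b)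
  have h1 := hasSum_ite_of_range (f := f) (fun p : ℤ × ℤ => (p.1 + p.2, p.1 - p.2 - 1))
    (fun p p' h => by
      simp only [Prod.mk.injEq] at h
      ext <;> lia)
    (fun p => (p.1 + p.2) % 2 = 1)
    (fun p => by
      constructor
      · intro h
        exact ⟨((p.1 + p.2 + 1) / 2, (p.1 - p.2 - 1) / 2), by ext <;> simp only <;> lia⟩
      · rintro ⟨q, rfl⟩
        simp only
        lia)
    (a := -(thetaHalf τ 0 a * thetaHalf τ 1 b)) (by
      refine hasSum_of_eq ((hasSum_thetaHalf hτ 0 a).mul_complex (hasSum_thetaHalf hτ 1 b)).neg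
        (fun p => ?_) rfl
      simp only [hf, Function.comp, thetaExp]
      rw [Odd.neg_one_zpow ⟨p.1 - 1, by ring⟩, ← exp_add, ← exp_add, neg_one_mul]
      congr 2
      push_cast
      ring)
  have h2 := hasSum_ite_of_range (f := f) (fun p : ℤ × ℤ => (p.1 + p.2, p.1 - p.2))
    (fun p p' h => by
      simp only [Prod.mk.injEq] at h
      ext <;> lia)
    (fun p => (p.1 + p.2) % 2 = 0)
    (fun p => by
      constructor
      · intro h
        exact ⟨((p.1 + p.2) / 2, (p.1 - p.2) / 2), by ext <;> simp only <;> lia⟩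
      · rintro ⟨q, rfl⟩
        simp only
        lia)
    (a := thetaHalf τ 1 a * thetaHalf τ 0 b) (by
      refine hasSum_of_eq ((hasSum_thetaHalf hτ 1 a).mul_complex (hasSum_thetaHalf hτ 0 b))
        (fun p => ?_) rfl
      simp only [hf, Function.comp, thetaExp]
      rw [Even.neg_one_zpow ⟨p.1, by ring⟩, ← exp_add, ← exp_add, one_mul]
      congr 1
      push_cast
      ring)
  have h3 : HasSum f (-(thetaHalf τ 0 a * thetaHalf τ 1 b) + thetaHalf τ 1 a * thetaHalf τ 0 b) := by
    refine hasSum_of_eq (h1.add h2) (fun p => ?_) rfl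
    rcases Int.emod_two_eq_zero_or_one (p.1 + p.2) with h | h <;> simp [h]
  linear_combination -(h0.unique h3)

/-- The three-term relation of Weierstrass for `θ₁`. -/
lemma theta1_weierstrass {τ : ℂ} (hτ : 0 < τ.im) (a b c d : ℂ) :
    theta1 (a + b) τ * theta1 (a - b) τ * (theta1 (c + d) τ * theta1 (c - d) τ) =
      theta1 (a + d) τ * theta1 (a - d) τ * (theta1 (c + b) τ * theta1 (c - b) τ) -
      theta1 (a + c) τ * theta1 (a - c) τ * (theta1 (d + b) τ * theta1 (d - b) τ) := by
  simp only [theta1_add_mul_theta1_sub hτ]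
  ring

/-- `e^{(2n+1)iw} - e^{-(2n+1)iw}`. -/
def sineCoeff (w : ℂ) (n : ℤ) : ℂ :=
  exp ((2 * (n : ℂ) + 1) * I * w) - exp (-((2 * (n : ℂ) + 1) * I * w))

lemma hasSum_theta1_sub {τ : ℂ} (hτ : 0 < τ.im) (z w : ℂ) :
    HasSum (fun n : ℤ => (-1 : ℂ) ^ n * thetaExp τ n z * sineCoeff w n)
      (I * (theta1 (z + w) τ - theta1 (z - w) τ)) := by
  refine hasSum_of_eq ((hasSum_theta1 hτ (z + w)).sub (hasSum_theta1 hτ (z - w)))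
    (fun n => ?_) ?_
  · have h1 : thetaExp τ n (z + w) = thetaExp τ n z * exp ((2 * (n : ℂ) + 1) * I * w) := by
      rw [thetaExp, thetaExp, ← exp_add]
      ring_nf
    have h2 : thetaExp τ n (z - w) = thetaExp τ n z * exp (-((2 * (n : ℂ) + 1) * I * w)) := by
      rw [thetaExp, thetaExp, ← exp_add]
      ring_nf
    rw [h1, h2, sineCoeff]
    ring
  · ring

lemma hasSum_theta1_sub_det {τ : ℂ} (hτ : 0 < τ.im) (x y w w' : ℂ) :
    HasSum (fun p : ℤ × ℤ => (-1 : ℂ) ^ (p.1 + p.2) * (thetaExp τ p.1 x * thetaExp τ p.2 y) *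
        (sineCoeff w p.1 * sineCoeff w' p.2 - sineCoeff w p.2 * sineCoeff w' p.1))
      (-((theta1 (x + w) τ - theta1 (x - w) τ) * (theta1 (y + w') τ - theta1 (y - w') τ) -
        (theta1 (y + w) τ - theta1 (y - w) τ) * (theta1 (x + w') τ - theta1 (x - w') τ))) := by
  refine hasSum_of_eq (((hasSum_theta1_sub hτ x w).mul_complex (hasSum_theta1_sub hτ y w')).sub
    ((hasSum_theta1_sub hτ x w').mul_complex (hasSum_theta1_sub hτ y w))) (fun p => ?_) ?_
  · rw [zpow_add₀ (by norm_num)]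
    ring
  · linear_combination (-((theta1 (x + w) τ - theta1 (x - w) τ) *
        (theta1 (y + w') τ - theta1 (y - w') τ) -
        (theta1 (y + w) τ - theta1 (y - w) τ) *
        (theta1 (x + w') τ - theta1 (x - w') τ))) * I_mul_I

lemma sineCoeff_emod_five (j n : ℤ) :
    sineCoeff (j * piC / 5) n = sineCoeff (j * piC / 5) (n % 5) := by
  have hn : (n : ℂ) = 5 * (n / 5 : ℤ) + (n % 5 : ℤ) := by
    exact_mod_cast (Int.mul_ediv_add_emod n 5).symm
  have h1 : exp ((2 * (n : ℂ) + 1) * I * (j * piC / 5)) =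
      exp ((2 * ((n % 5 : ℤ) : ℂ) + 1) * I * (j * piC / 5)) := by
    rw [exp_eq_exp_iff_exists_int]
    refine ⟨j * (n / 5), ?_⟩
    rw [hn, piC]
    push_cast
    ring
  rw [sineCoeff, sineCoeff, exp_neg, exp_neg, h1]

lemma sineCoeff_eq_sin (w : ℂ) (n : ℤ) : sineCoeff w n = 2 * I * sin ((2 * (n : ℂ) + 1) * w) := by
  rw [sineCoeff, sin,
    show (2 * (n : ℂ) + 1) * I * w = (2 * (n : ℂ) + 1) * w * I by ring, ← neg_mul]
  linear_combination (-(exp (-((2 * (n : ℂ) + 1) * w) * I) - exp ((2 * (n : ℂ) + 1) * w * I))) *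
    I_mul_I

lemma sin_sq_add_sin_sq_pi_div_five : sin (piC / 5) ^ 2 + sin (2 * piC / 5) ^ 2 = 5 / 4 := by
  have hc : cos (piC / 5) = (((1 + √5) / 4 : ℝ) : ℂ) := by
    rw [← Real.cos_pi_div_five, piC]
    push_cast
    rfl
  have h5 : ((√5 : ℝ) : ℂ) ^ 2 = 5 := by
    exact_mod_cast congrArg ((↑) : ℝ → ℂ) (Real.sq_sqrt (by norm_num : (0 : ℝ) ≤ 5))
  rw [show 2 * piC / 5 = 2 * (piC / 5) by ring, sin_two_mul, mul_pow, mul_pow, sin_sq, hc]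
  push_cast
  linear_combination ((1 - 4 * (√5 : ℝ) - (√5 : ℝ) ^ 2) / 64) * h5

lemma sineCoeff_pi_div_five (n : ℤ) : sineCoeff (piC / 5) n =
    if n % 5 = 0 then 2 * I * sin (piC / 5) else if n % 5 = 1 then 2 * I * sin (2 * piC / 5) else
    if n % 5 = 2 then 0 else if n % 5 = 3 then -(2 * I * sin (2 * piC / 5)) else
    -(2 * I * sin (piC / 5)) := by
  have h := sineCoeff_emod_five 1 n
  rw [Int.cast_one, one_mul] at h
  rw [h, sineCoeff_eq_sin]
  have hr : n % 5 = 0 ∨ n % 5 = 1 ∨ n % 5 = 2 ∨ n % 5 = 3 ∨ n % 5 = 4 := by lia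
  rcases hr with h | h | h | h | h <;> simp only [h] <;> norm_num
  · rw [← sin_pi_sub, piC]
    ring_nf
  · rw [show (5 : ℂ) * (piC / 5) = Real.pi by rw [piC]; ring, sin_pi]
  · rw [show 7 * (piC / 5) = 2 * piC / 5 + Real.pi by rw [piC]; ring, sin_add_pi]
    ring
  · rw [show 9 * (piC / 5) = 2 * Real.pi - piC / 5 by rw [piC]; ring, sin_two_pi_sub]
    ring

lemma sineCoeff_two_pi_div_five (n : ℤ) : sineCoeff (2 * piC / 5) n =
    if n % 5 = 0 then 2 * I * sin (2 * piC / 5) else if n % 5 = 1 then -(2 * I * sin (piC / 5)) else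
    if n % 5 = 2 then 0 else if n % 5 = 3 then 2 * I * sin (piC / 5) else
    -(2 * I * sin (2 * piC / 5)) := by
  have h := sineCoeff_emod_five 2 n
  rw [Int.cast_ofNat] at h
  rw [h, sineCoeff_eq_sin]
  have hr : n % 5 = 0 ∨ n % 5 = 1 ∨ n % 5 = 2 ∨ n % 5 = 3 ∨ n % 5 = 4 := by lia
  rcases hr with h | h | h | h | h <;> simp only [h] <;> norm_num
  · rw [show 3 * (2 * piC / 5) = piC / 5 + Real.pi by rw [piC]; ring, sin_add_pi]
    ring
  · rw [show 5 * (2 * piC / 5) = 2 * Real.pi by rw [piC]; ring, sin_two_pi]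
  · rw [show 7 * (2 * piC / 5) = Real.pi - piC / 5 + 2 * Real.pi by rw [piC]; ring,
      sin_add_two_pi, sin_pi_sub]
  · rw [show 9 * (2 * piC / 5) = 2 * Real.pi - 2 * piC / 5 + 2 * Real.pi by rw [piC]; ring,
      sin_add_two_pi, sin_two_pi_sub]
    ring

lemma sineCoeff_det (m n : ℤ) :
    sineCoeff (piC / 5) m * sineCoeff (2 * piC / 5) n -
      sineCoeff (piC / 5) n * sineCoeff (2 * piC / 5) m =
    -5 * ((if (n - 2 * m) % 5 = 3 then 1 else 0) - if (n + 2 * m) % 5 = 1 then 1 else 0) := by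
  have key : (2 * I * sin (piC / 5)) ^ 2 + (2 * I * sin (2 * piC / 5)) ^ 2 = -5 := by
    linear_combination (-4) * sin_sq_add_sin_sq_pi_div_five +
      4 * (sin (piC / 5) ^ 2 + sin (2 * piC / 5) ^ 2) * I_sq
  simp only [sineCoeff_pi_div_five, sineCoeff_two_pi_div_five]
  rw [show (n - 2 * m) % 5 = (n % 5 - 2 * (m % 5)) % 5 by lia,
    show (n + 2 * m) % 5 = (n % 5 + 2 * (m % 5)) % 5 by lia]
  generalize 2 * I * sin (piC / 5) = s at *
  generalize 2 * I * sin (2 * piC / 5) = t at *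
  have hm : m % 5 = 0 ∨ m % 5 = 1 ∨ m % 5 = 2 ∨ m % 5 = 3 ∨ m % 5 = 4 := by lia
  have hn : n % 5 = 0 ∨ n % 5 = 1 ∨ n % 5 = 2 ∨ n % 5 = 3 ∨ n % 5 = 4 := by lia
  rcases hm with hm | hm | hm | hm | hm <;> rcases hn with hn | hn | hn | hn | hn <;>
    simp only [hm, hn] <;> norm_num <;> first | ring1 | linear_combination key |
      linear_combination -key

lemma theta1_sub_det {τ : ℂ} (hτ : 0 < τ.im) (x y : ℂ) :
    (theta1 (x + piC / 5) τ - theta1 (x - piC / 5) τ) *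
        (theta1 (y + 2 * piC / 5) τ - theta1 (y - 2 * piC / 5) τ)
      - (theta1 (y + piC / 5) τ - theta1 (y - piC / 5) τ) *
        (theta1 (x + 2 * piC / 5) τ - theta1 (x - 2 * piC / 5) τ) =
    5 * (theta1 (x + 2 * y) (5 * τ) * theta1 (2 * x - y) (5 * τ) -
      theta1 (2 * y - x) (5 * τ) * theta1 (2 * x + y) (5 * τ)) := by
  have hτ5 : 0 < (5 * τ).im := by
    simpa using hτ
  set f : ℤ × ℤ → ℂ := fun p =>
    (-1 : ℂ) ^ (p.1 + p.2) * (thetaExp τ p.1 x * thetaExp τ p.2 y) with hf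
  have h0 := hasSum_theta1_sub_det hτ x y (piC / 5) (2 * piC / 5)
  simp only [sineCoeff_det] at h0
  have h1 := hasSum_ite_of_range (f := f) (fun p : ℤ × ℤ => (p.1 + 2 * p.2 + 1, 2 * p.1 - p.2))
    (fun p p' h => by
      simp only [Prod.mk.injEq] at h
      ext <;> lia)
    (fun p => (p.2 - 2 * p.1) % 5 = 3)
    (fun p => by
      constructor
      · intro h
        exact ⟨((p.1 - 1 + 2 * p.2) / 5, (2 * (p.1 - 1) - p.2) / 5), by
          ext <;> simp only <;> lia⟩
      · rintro ⟨q, rfl⟩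
        simp only
        lia)
    (a := theta1 (x + 2 * y) (5 * τ) * theta1 (2 * x - y) (5 * τ)) (by
      refine hasSum_of_eq (hasSum_theta1_mul hτ5 (x + 2 * y) (2 * x - y)).neg (fun p => ?_) ?_
      · simp only [hf, Function.comp, thetaExp]
        rw [show p.1 + 2 * p.2 + 1 + (2 * p.1 - p.2) = p.1 + p.2 + (2 * p.1 + 1) by ring,
          zpow_add₀ (by norm_num), Odd.neg_one_zpow ⟨p.1, rfl⟩, ← exp_add, ← exp_add,
          mul_neg_one, neg_mul]
        congr 3
        push_cast
        ring
      · ring)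
  have h2 := hasSum_ite_of_range (f := f) (fun p : ℤ × ℤ => (2 * p.2 - p.1, 2 * p.1 + p.2 + 1))
    (fun p p' h => by
      simp only [Prod.mk.injEq] at h
      ext <;> lia)
    (fun p => (p.2 + 2 * p.1) % 5 = 1)
    (fun p => by
      constructor
      · intro h
        exact ⟨((2 * (p.2 - 1) - p.1) / 5, (2 * p.1 + p.2 - 1) / 5), by
          ext <;> simp only <;> lia⟩
      · rintro ⟨q, rfl⟩
        simp only
        lia)
    (a := theta1 (2 * y - x) (5 * τ) * theta1 (2 * x + y) (5 * τ)) (by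
      refine hasSum_of_eq (hasSum_theta1_mul hτ5 (2 * y - x) (2 * x + y)).neg (fun p => ?_) ?_
      · simp only [hf, Function.comp, thetaExp]
        rw [show 2 * p.2 - p.1 + (2 * p.1 + p.2 + 1) = p.1 + p.2 + (2 * p.2 + 1) by ring,
          zpow_add₀ (by norm_num), Odd.neg_one_zpow ⟨p.2, rfl⟩, ← exp_add, ← exp_add,
          mul_neg_one, neg_mul]
        congr 3
        push_cast
        ring
      · ring)
  have h3 := (h1.sub h2).mul_left (-5)
  have h4 := h0.unique (hasSum_of_eq h3 (fun p => by
    simp only [hf]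
    split_ifs <;> ring) rfl)
  simp only [mul_div_assoc] at h4 ⊢
  linear_combination -h4

theorem statement17 (τ : ℂ) (hτ : 0 < τ.im) (x y : ℂ)
    (hx : theta1 x (5 * τ) ≠ 0) (hy : theta1 y (5 * τ) ≠ 0) :
    (theta1 (x + piC / 5) τ - theta1 (x - piC / 5) τ) *
        (theta1 (y + 2 * piC / 5) τ - theta1 (y - 2 * piC / 5) τ)
      - (theta1 (y + piC / 5) τ - theta1 (y - piC / 5) τ) *
        (theta1 (x + 2 * piC / 5) τ - theta1 (x - 2 * piC / 5) τ) =
    5 * theta1 (x + y) (5 * τ) * theta1 (x - y) (5 * τ) *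
        theta1 (2 * x) (5 * τ) * theta1 (2 * y) (5 * τ) /
      (theta1 x (5 * τ) * theta1 y (5 * τ)) := by
  rw [theta1_sub_det hτ, eq_div_iff (mul_ne_zero hx hy)]
  have h := theta1_weierstrass (τ := 5 * τ) (by simpa using hτ) (x + y) (x - y) x y
  rw [show x + y + (x - y) = 2 * x by ring, show x + y - (x - y) = 2 * y by ring,
    show x + y + y = x + 2 * y by ring, show x + y - y = x by ring,
    show x + (x - y) = 2 * x - y by ring, show x - (x - y) = y by ring,
    show x + y + x = 2 * x + y by ring, show x + y - x = y by ring,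
    show y + (x - y) = x by ring, show y - (x - y) = 2 * y - x by ring] at h
  linear_combination -5 * h
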